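/- arXiv:2410.23024 — 4 statements merged into one kernel-verified Lean document; each statement's English description precedes it below -/
import Mathlib

section
/- With Ξ, H, m, α, γ, Φ as in the context, Φ satisfies the functional equation Φ(x+h) = Φ(x)·(α(h)·m(h,x))⁻¹ for all x ∈ Ξ and all h ∈ H. -/
/-- With `Ξ, H, m, α, γ, Φ` as in the context, `Φ` satisfies the functional
equation `Φ(x+h) = Φ(x)·(α(h)·m(h,x))⁻¹` for all `x ∈ Ξ` and `h ∈ H`. -/
theorem Phi_functional_equation
    {Ξ : Type*} [AddCommGroup Ξ] (m : Ξ → Ξ → Circle)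
    (hm_cocycle : ∀ x y z : Ξ, m (x + y) z * m x y = m x (y + z) * m y z)
    (hm_right : ∀ x : Ξ, m x 0 = 1) (hm_left : ∀ x : Ξ, m 0 x = 1)
    (H : AddSubgroup Ξ) (α : Ξ → Circle) (hα0 : α 0 = 1)
    (hα : ∀ h ∈ H, ∀ k ∈ H, m h k = α (h + k) * (α h)⁻¹ * (α k)⁻¹)
    (γ : Ξ → Ξ) (hγ_mem : ∀ x : Ξ, x - γ x ∈ H)
    (hγ_inv : ∀ x : Ξ, ∀ h ∈ H, γ (x + h) = γ x)
    (Φ : Ξ → Circle) (hΦ : ∀ x : Ξ, Φ x = (α (x - γ x) * m (x - γ x) (γ x))⁻¹) :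
    ∀ x : Ξ, ∀ h ∈ H, Φ (x + h) = Φ x * (α h * m h x)⁻¹ := by
  intro x h hh
  have hshift : x + h - γ x = h + (x - γ x) := by abel
  have hα_add : α (h + (x - γ x)) = m h (x - γ x) * α (x - γ x) * α h := by
    rw [hα h hh _ (hγ_mem x)]
    simp
  have hc := hm_cocycle h (x - γ x) (γ x)
  rw [sub_add_cancel] at hc
  rw [hΦ, hΦ, hγ_inv x h hh, hshift, ← mul_inv, hα_add]
  congr 1
  calc m h (x - γ x) * α (x - γ x) * α h * m (h + (x - γ x)) (γ x)
      = α (x - γ x) * α h * (m (h + (x - γ x)) (γ x) * m h (x - γ x)) := by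
        ac_rfl
    _ = α (x - γ x) * m (x - γ x) (γ x) * (α h * m h x) := by
        rw [hc]
        ac_rfl
end

section
/- With Ξ, H, m, α, γ, Φ as in the context, for every fixed x ∈ Ξ the function t ↦ Φ(t+x)·Φ(t)⁻¹·m(t,x) is H-invariant: for all t ∈ Ξ and h ∈ H, Φ(t+h+x)·Φ(t+h)⁻¹·m(t+h,x) = Φ(t+x)·Φ(t)⁻¹·m(t,x). -/
/-- Translating by `h ∈ H` multiplies `Φ⁻¹` by `α h * m h ·`. -/
theorem multiplier_section_translate {Ξ G : Type*} [AddCommGroup Ξ] [CommGroup G]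
    {m : Ξ → Ξ → G} (hm : ∀ x y z : Ξ, m (x + y) z * m x y = m x (y + z) * m y z)
    {H : AddSubgroup Ξ} {α : Ξ → G}
    (hα : ∀ h ∈ H, ∀ k ∈ H, m h k = α (h + k) * (α h)⁻¹ * (α k)⁻¹)
    {γ : Ξ → Ξ} (hγ_mem : ∀ x : Ξ, x - γ x ∈ H)
    (hγ_inv : ∀ x : Ξ, ∀ h ∈ H, γ (x + h) = γ x)
    {Φ : Ξ → G} (hΦ : ∀ x : Ξ, Φ x = (α (x - γ x) * m (x - γ x) (γ x))⁻¹)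
    (t : Ξ) {h : Ξ} (hh : h ∈ H) :
    (Φ (t + h))⁻¹ = α h * m h t * (Φ t)⁻¹ := by
  have hc := hm h (t - γ t) (γ t)
  rw [sub_add_cancel] at hc
  have hα' : α (h + (t - γ t)) = m h (t - γ t) * α (t - γ t) * α h := by
    rw [hα h hh _ (hγ_mem t), inv_mul_cancel_right, inv_mul_cancel_right]
  rw [hΦ, hΦ, inv_inv, inv_inv, hγ_inv t h hh, add_comm t h, add_sub_assoc, hα']
  calc
    _ = α h * α (t - γ t) * (m (h + (t - γ t)) (γ t) * m h (t - γ t)) := by ac_rfl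
    _ = α h * α (t - γ t) * (m h t * m (t - γ t) (γ t)) := by rw [hc]
    _ = _ := by ac_rfl


/-- With `Ξ, H, m, α, γ, Φ` as in the context, for every fixed `x ∈ Ξ` the
function `t ↦ Φ(t+x)·Φ(t)⁻¹·m(t,x)` is `H`-invariant. -/
theorem Phi_quotient_H_invariant
    {Ξ : Type*} [AddCommGroup Ξ] (m : Ξ → Ξ → Circle)
    (hm_cocycle : ∀ x y z : Ξ, m (x + y) z * m x y = m x (y + z) * m y z)
    (hm_right : ∀ x : Ξ, m x 0 = 1) (hm_left : ∀ x : Ξ, m 0 x = 1)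
    (H : AddSubgroup Ξ) (α : Ξ → Circle) (hα0 : α 0 = 1)
    (hα : ∀ h ∈ H, ∀ k ∈ H, m h k = α (h + k) * (α h)⁻¹ * (α k)⁻¹)
    (γ : Ξ → Ξ) (hγ_mem : ∀ x : Ξ, x - γ x ∈ H)
    (hγ_inv : ∀ x : Ξ, ∀ h ∈ H, γ (x + h) = γ x)
    (Φ : Ξ → Circle) (hΦ : ∀ x : Ξ, Φ x = (α (x - γ x) * m (x - γ x) (γ x))⁻¹) :
    ∀ x t : Ξ, ∀ h ∈ H,
      Φ (t + h + x) * (Φ (t + h))⁻¹ * m (t + h) x = Φ (t + x) * (Φ t)⁻¹ * m t x := by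
  intro x t h hh
  have translate := fun s : Ξ =>
    multiplier_section_translate hm_cocycle hα hγ_mem hγ_inv hΦ s hh
  have hΦx : Φ (t + x) = α h * m h (t + x) * Φ (t + h + x) := by
    have := translate (t + x)
    rwa [add_right_comm, inv_eq_iff_eq_inv, mul_inv, inv_inv, mul_comm, eq_mul_inv_iff_mul_eq,
      mul_comm, eq_comm] at this
  have hc := hm_cocycle h t x
  rw [add_comm h t] at hc
  rw [translate t, hΦx]
  calc
    _ = Φ (t + h + x) * α h * (Φ t)⁻¹ * (m (t + h) x * m h t) := by ac_rfl
    _ = Φ (t + h + x) * α h * (Φ t)⁻¹ * (m h (t + x) * m t x) := by rw [hc]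
    _ = _ := by ac_rfl
end

section
/- With Ξ, H, m, α, γ, Φ as in the context, and with σ(x,y) = m(x,y)·m(y,x)⁻¹, for every h ∈ H and every t ∈ Ξ one has Φ(t+h)·Φ(t)⁻¹·m(t,h) = α(h)⁻¹·σ(t,h). -/
/-- With `Ξ, H, m, α, γ, Φ` as in the context and `σ(x,y) = m(x,y)·m(y,x)⁻¹`,
for every `h ∈ H` and `t ∈ Ξ` one has `Φ(t+h)·Φ(t)⁻¹·m(t,h) = α(h)⁻¹·σ(t,h)`. -/
theorem Phi_quotient_on_H
    {Ξ : Type*} [AddCommGroup Ξ] (m : Ξ → Ξ → Circle)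
    (hm_cocycle : ∀ x y z : Ξ, m (x + y) z * m x y = m x (y + z) * m y z)
    (hm_right : ∀ x : Ξ, m x 0 = 1) (hm_left : ∀ x : Ξ, m 0 x = 1)
    (H : AddSubgroup Ξ) (α : Ξ → Circle) (hα0 : α 0 = 1)
    (hα : ∀ h ∈ H, ∀ k ∈ H, m h k = α (h + k) * (α h)⁻¹ * (α k)⁻¹)
    (γ : Ξ → Ξ) (hγ_mem : ∀ x : Ξ, x - γ x ∈ H)
    (hγ_inv : ∀ x : Ξ, ∀ h ∈ H, γ (x + h) = γ x)
    (Φ : Ξ → Circle) (hΦ : ∀ x : Ξ, Φ x = (α (x - γ x) * m (x - γ x) (γ x))⁻¹)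
    (σ : Ξ → Ξ → Circle) (hσ : ∀ x y : Ξ, σ x y = m x y * (m y x)⁻¹) :
    ∀ h ∈ H, ∀ t : Ξ, Φ (t + h) * (Φ t)⁻¹ * m t h = (α h)⁻¹ * σ t h := by
  intro h hh t
  have hg : γ (t + h) = γ t := hγ_inv t h hh
  have hsub : t + h - γ t = h + (t - γ t) := by abel
  have hc := hm_cocycle h (t - γ t) (γ t)
  rw [sub_add_cancel] at hc
  have hα_add : α (h + (t - γ t)) = m h (t - γ t) * α h * α (t - γ t) := by
    rw [hα h hh _ (hγ_mem t), mul_right_comm _ (α (t - γ t))⁻¹, inv_mul_cancel_right,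
      inv_mul_cancel_right]
  have hquot : α (h + (t - γ t)) * m (h + (t - γ t)) (γ t) =
      α h * m h t * (α (t - γ t) * m (t - γ t) (γ t)) := by
    rw [hα_add]
    calc _ = α h * α (t - γ t) * (m (h + (t - γ t)) (γ t) * m h (t - γ t)) := by ac_rfl
      _ = _ := by rw [hc]; ac_rfl
  rw [hΦ, hΦ, hσ, hg, hsub, hquot, mul_inv, inv_inv, inv_mul_cancel_right, mul_inv,
    mul_assoc, mul_comm (m h t)⁻¹]
end

section
/- Let Ξ = ℤ × 𝕋, where 𝕋 = {z ∈ ℂ : |z| = 1} is the circle group, and define σ : Ξ × Ξ → 𝕋 by σ((k,θ),(n,ϑ)) = ϑ^k · θ^{−n}. Then: (1) for every ϑ₀ ∈ 𝕋 the set H_{ϑ₀} = {(k, ϑ₀^k) : k ∈ ℤ} is a subgroup of Ξ satisfying (H_{ϑ₀})^σ = H_{ϑ₀}; and (2) the subgroup {0} × 𝕋 satisfies ({0} × 𝕋)^σ = {0} × 𝕋. Here H^σ = {z ∈ Ξ : σ(z,w) = 1 for all w ∈ H}. -/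
/-- Only the zeroth power map on the circle is trivial. -/
theorem Circle.eq_zero_of_forall_zpow_eq_one {k : ℤ} (h : ∀ z : Circle, z ^ k = 1) : k = 0 := by
  by_contra hk
  have hk' : (k : ℝ) ≠ 0 := Int.cast_ne_zero.mpr hk
  have h1 := h (Circle.exp (Real.pi / k))
  rw [← Circle.exp_zsmul, zsmul_eq_mul, mul_div_cancel₀ _ hk'] at h1
  have h2 := congrArg (fun z : Circle => (z : ℂ)) h1
  simp only [Circle.coe_exp, Complex.exp_pi_mul_I, Circle.coe_one] at h2
  norm_num at h2

/-- For `Ξ = ℤ × 𝕋` with `σ((k,θ),(n,ϑ)) = ϑ^k · θ^{−n}`, each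
`H_{ϑ₀} = {(k, ϑ₀^k) : k ∈ ℤ}` is a Lagrangian subgroup, and `{0} × 𝕋` is Lagrangian.
(The circle group `𝕋` is written additively as `Additive Circle` so that `Ξ` is an
additive abelian group.) -/
theorem lagrangian_subgroups_of_Z_times_T
    (σ : (ℤ × Additive Circle) → (ℤ × Additive Circle) → Circle)
    (hσ : ∀ (k n : ℤ) (θ ϑ : Circle),
      σ (k, Additive.ofMul θ) (n, Additive.ofMul ϑ) = ϑ ^ k * θ ^ (-n)) :
    (∀ ϑ₀ : Circle,
      (∃ S : AddSubgroup (ℤ × Additive Circle),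
        (S : Set (ℤ × Additive Circle))
          = {p : ℤ × Additive Circle | ∃ k : ℤ, p = (k, Additive.ofMul (ϑ₀ ^ k))}) ∧
      {z : ℤ × Additive Circle |
          ∀ w ∈ {p : ℤ × Additive Circle | ∃ k : ℤ, p = (k, Additive.ofMul (ϑ₀ ^ k))},
            σ z w = 1}
        = {p : ℤ × Additive Circle | ∃ k : ℤ, p = (k, Additive.ofMul (ϑ₀ ^ k))}) ∧
    ((∃ S : AddSubgroup (ℤ × Additive Circle),
        (S : Set (ℤ × Additive Circle)) = {p : ℤ × Additive Circle | p.1 = 0}) ∧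
      {z : ℤ × Additive Circle |
          ∀ w ∈ {p : ℤ × Additive Circle | p.1 = 0}, σ z w = 1}
        = {p : ℤ × Additive Circle | p.1 = 0}) := by
  refine ⟨fun ϑ₀ => ⟨⟨AddSubgroup.zmultiples (1, Additive.ofMul ϑ₀), ?_⟩, ?_⟩,
    ⟨(AddMonoidHom.fst ℤ (Additive Circle)).ker, ?_⟩, ?_⟩
  · ext p
    simp [AddSubgroup.mem_zmultiples_iff, eq_comm]
  · ext ⟨k, θ⟩
    obtain ⟨θ, rfl⟩ := Additive.ofMul.surjective θ
    constructor
    · intro h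
      have h1 := h _ ⟨1, rfl⟩
      rw [hσ, zpow_one, zpow_neg_one, mul_inv_eq_one] at h1
      exact ⟨k, by rw [h1]⟩
    · rintro ⟨m, hm⟩ _ ⟨n, rfl⟩
      obtain ⟨rfl, hθ⟩ := Prod.ext_iff.mp hm
      obtain rfl : θ = ϑ₀ ^ k := Additive.ofMul.injective hθ
      rw [hσ, ← zpow_mul, ← zpow_mul, ← zpow_add, mul_neg, mul_comm, add_neg_cancel, zpow_zero]
  · ext p
    exact AddMonoidHom.mem_ker
  · ext ⟨k, θ⟩
    constructor
    · intro h
      refine Circle.eq_zero_of_forall_zpow_eq_one fun z => ?_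
      have h1 := h (0, Additive.ofMul z) rfl
      rwa [← ofMul_toMul θ, hσ, neg_zero, zpow_zero, mul_one] at h1
    · rintro hk ⟨n, ϑ⟩ hn
      obtain rfl : k = 0 := hk
      obtain rfl : n = 0 := hn
      rw [← ofMul_toMul θ, ← ofMul_toMul ϑ, hσ]
      simp
end
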